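/- arXiv:1212.5971 — 2 statements merged into one kernel-verified Lean document; each statement's English description precedes it below -/
import Mathlib

section
/- For every real number q with 0 < q < 1, the character of the τ-twisted W₃(4/5)-module W^τ(1/40) has the Rogers–Ramanujan product form: χ_{5,6}^{2,2}(q) + χ_{5,6}^{2,4}(q) = q^{−1/120} · ∏_{n=0}^∞ 1/((1 − q^{(5n+1)/2})(1 − q^{(5n+4)/2})). -/
open scoped BigOperators

/-- The Euler product `(q)_∞ = ∏_{i=1}^∞ (1 - q^i)`. -/
noncomputable def eulerProd (q : ℝ) : ℝ := ∏' i : ℕ, (1 - q ^ (i + 1))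

/-- The Virasoro minimal model character `χ_{s,t}^{m,n}(q)`:
`q^(h - c/24) · (q)_∞⁻¹ · Σ_{k∈ℤ} q^(s t k²) (q^(k(mt-ns)) - q^((mt+ns)k+mn))`,
where `c = 1 - 6(s-t)²/(st)` and `h = ((mt-ns)² - (s-t)²)/(4st)`. -/
noncomputable def minChar (s t m n : ℤ) (q : ℝ) : ℝ :=
  q ^ ((((((m * t - n * s) ^ 2 - (s - t) ^ 2 : ℤ) : ℝ)) / (4 * (s : ℝ) * (t : ℝ))) -
        (1 - 6 * ((s : ℝ) - (t : ℝ)) ^ 2 / ((s : ℝ) * (t : ℝ))) / 24) *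
    (eulerProd q)⁻¹ *
    ∑' k : ℤ, ((q ^ (s * t * k ^ 2 + k * (m * t - n * s)) : ℝ) -
               (q ^ (s * t * k ^ 2 + (m * t + n * s) * k + m * n) : ℝ))

open Finset Filter Topology

/-- The finite `q`-shifted factorial `(a; q)_n = ∏_{i < n} (1 - a q^i)`. -/
noncomputable def qPoch (a q : ℝ) (n : ℕ) : ℝ := ∏ i ∈ range n, (1 - a * q ^ i)

/-- The infinite `q`-shifted factorial `(a; q)_∞ = ∏_{i ≥ 0} (1 - a q^i)`. -/
noncomputable def qPochInf (a q : ℝ) : ℝ := ∏' i : ℕ, (1 - a * q ^ i)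

@[simp] lemma qPoch_zero (a q : ℝ) : qPoch a q 0 = 1 := by simp [qPoch]

lemma qPoch_succ (a q : ℝ) (n : ℕ) : qPoch a q (n + 1) = qPoch a q n * (1 - a * q ^ n) :=
  prod_range_succ _ _

lemma qPoch_succ' (a q : ℝ) (n : ℕ) : qPoch a q (n + 1) = (1 - a) * qPoch (a * q) q n := by
  simp only [qPoch, prod_range_succ', pow_zero, mul_one, pow_succ']
  rw [mul_comm]
  simp only [mul_assoc]

lemma qPoch_ne_zero {a q : ℝ} (h : ∀ i : ℕ, a * q ^ i ≠ 1) (n : ℕ) : qPoch a q n ≠ 0 :=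
  prod_ne_zero_iff.mpr fun i _ => sub_ne_zero.mpr (h i).symm

/-- The summand of the finite quintuple product identity. -/
noncomputable def quintTerm (z q : ℝ) (n k : ℕ) : ℝ :=
  (1 + z * q ^ k) * z ^ k * q ^ k ^ 2 * (qPoch q q n * qPoch z q (n + 1)) /
    (qPoch q q k * qPoch q q (n - k) * qPoch (z ^ 2 * q ^ k) q (n + 1))

lemma sum_range_quintTerm_succ_sub {z q : ℝ} (hq : ∀ i : ℕ, q * q ^ i ≠ 1)
    (hz2 : ∀ i : ℕ, z ^ 2 * q ^ i ≠ 1) (n K : ℕ) (hK : K ≤ n) :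
    ∑ k ∈ range (K + 1), (quintTerm z q (n + 1) k - quintTerm z q n k) =
      -(z ^ (K + 1) * q ^ (K + 1) ^ 2 * q ^ (n - K) * (qPoch q q n * qPoch z q (n + 1)) /
        (qPoch q q K * qPoch q q (n - K) * qPoch (z ^ 2 * q ^ (K + 1)) q (n + 1))) := by
  have hz2' (k n : ℕ) : qPoch (z ^ 2 * q ^ k) q n ≠ 0 :=
    qPoch_ne_zero (fun i => by rw [mul_assoc, ← pow_add]; exact hz2 _) n
  have hqn := qPoch_ne_zero hq
  have shift (k n : ℕ) : qPoch (z ^ 2 * q ^ (k + 1)) q (n + 1) =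
      qPoch (z ^ 2 * q ^ k) q (n + 1) * (1 - z ^ 2 * q ^ k * q ^ (n + 1)) /
        (1 - z ^ 2 * q ^ k) := by
    rw [eq_div_iff (sub_ne_zero.mpr (hz2 k).symm), ← qPoch_succ, qPoch_succ' _ _ (n + 1), pow_succ]
    ring_nf
  have hk (k : ℕ) : 1 - z ^ 2 * q ^ k ≠ 0 := sub_ne_zero.mpr (hz2 k).symm
  have hk' (k : ℕ) : 1 - q * q ^ k ≠ 0 := sub_ne_zero.mpr (hq k).symm
  have hkn (k n : ℕ) : 1 - z ^ 2 * q ^ k * q ^ n ≠ 0 := by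
    rw [mul_assoc, ← pow_add]; exact hk _
  induction K with
  | zero =>
    simp only [zero_add, range_one, sum_singleton, quintTerm, shift 0 n, Nat.sub_zero]
    rw [qPoch_succ q q n, qPoch_succ z q (n + 1), qPoch_succ (z ^ 2 * q ^ 0) q (n + 1)]
    have := hk 0
    have := hk' n
    have := hkn 0 (n + 1)
    have := hz2' 0 (n + 1)
    have := hqn n
    simp only [pow_zero, mul_one, qPoch_zero, one_mul] at *
    field_simp
    ring
  | succ K ih =>
    obtain ⟨d, rfl⟩ : ∃ d, n = K + 1 + d := ⟨n - (K + 1), by omega⟩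
    rw [sum_range_succ, ih (by omega)]
    simp only [quintTerm, shift (K + 1)]
    rw [show K + 1 + d + 1 - (K + 1) = d + 1 by omega, show K + 1 + d - (K + 1) = d by omega,
      show K + 1 + d - K = d + 1 by omega, qPoch_succ q q (K + 1 + d),
      qPoch_succ z q (K + 1 + d + 1), qPoch_succ (z ^ 2 * q ^ (K + 1)) q (K + 1 + d + 1),
      qPoch_succ q q K, qPoch_succ q q d]
    have h1 := hk (K + 1)
    have h2 := hk' K
    have h3 := hk' d
    have h4 := hkn (K + 1) (K + 1 + d + 1)
    have h5 := hz2' (K + 1) (K + 1 + d + 1)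
    have h6 := hqn K
    have h7 := hqn d
    rw [show (K + 1 + 1) ^ 2 = (K + 1) ^ 2 + (2 * K + 3) by ring, pow_add q ((K + 1) ^ 2)]
    generalize qPoch (z ^ 2 * q ^ (K + 1)) q (K + 1 + d + 1) = A at *
    generalize qPoch q q K = B at *
    generalize qPoch q q d = C at *
    generalize qPoch q q (K + 1 + d) = D at *
    generalize qPoch z q (K + 1 + d + 1) = E at *
    generalize q ^ (K + 1) ^ 2 = S at *
    rw [show 2 * K + 3 = 2 * K + 2 + 1 by ring]
    simp only [pow_succ, pow_add, pow_mul'] at *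
    generalize q ^ K = x at *
    generalize q ^ d = y at *
    generalize z ^ K = w at *
    clear ih shift hz2' hkn hk hk' hqn hq hz2
    obtain ⟨u, hu⟩ : ∃ u, u = 1 - z * z * (x * q) * (x * q * y * q) := ⟨_, rfl⟩
    obtain ⟨v, hv⟩ : ∃ v, v = 1 - q * y := ⟨_, rfl⟩
    obtain ⟨s, hs⟩ : ∃ s, s = 1 - z * z * (x * q) := ⟨_, rfl⟩
    obtain ⟨t, ht⟩ : ∃ t, t = 1 - q * x := ⟨_, rfl⟩
    simp only [pow_zero, one_mul, ← hu, ← hv, ← hs, ← ht] at h1 h2 h3 h4 ⊢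
    field_simp
    rw [hu, hv, hs, ht]
    ring

/-- The finite form of the quintuple product identity. -/
theorem sum_range_quintTerm {z q : ℝ} (hq : ∀ i : ℕ, q * q ^ i ≠ 1)
    (hz : ∀ i : ℕ, z * q ^ i ≠ 1) (hz2 : ∀ i : ℕ, z ^ 2 * q ^ i ≠ 1) (n : ℕ) :
    ∑ k ∈ range (n + 1), quintTerm z q n k = 1 := by
  have hz2' (k n : ℕ) : qPoch (z ^ 2 * q ^ k) q n ≠ 0 :=
    qPoch_ne_zero (fun i => by rw [mul_assoc, ← pow_add]; exact hz2 _) n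
  induction n with
  | zero =>
    have h1 : 1 - z ≠ 0 := sub_ne_zero.mpr (by simpa using (hz 0).symm)
    have h2 : 1 - z ^ 2 ≠ 0 := sub_ne_zero.mpr (by simpa using (hz2 0).symm)
    simp [quintTerm, qPoch_succ]
    field_simp
    ring
  | succ n ih =>
    have h := sum_range_quintTerm_succ_sub hq hz2 n n le_rfl
    rw [sum_sub_distrib, ih, sub_eq_iff_eq_add] at h
    rw [sum_range_succ, h, quintTerm, qPoch_succ z q (n + 1),
      qPoch_succ (z ^ 2 * q ^ (n + 1)) q (n + 1)]
    have h1 := hz2' (n + 1) (n + 1)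
    have h2 := qPoch_ne_zero hq n
    have h2' := qPoch_ne_zero hq (n + 1)
    have h3 : 1 - z ^ 2 * q ^ (n + 1) * q ^ (n + 1) ≠ 0 := by
      rw [mul_assoc, ← pow_add]; exact sub_ne_zero.mpr (hz2 _).symm
    obtain ⟨u, hu⟩ : ∃ u, u = 1 - z ^ 2 * q ^ (n + 1) * q ^ (n + 1) := ⟨_, rfl⟩
    simp only [Nat.sub_self, pow_zero, qPoch_zero, ← hu] at h3 ⊢
    field_simp
    rw [hu]
    ring

/-- Reflection of a finite `q`-shifted factorial. -/
lemma qPoch_div_pow {y q : ℝ} (hy : y ≠ 0) (hq : q ≠ 0) (a b : ℕ) :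
    qPoch (y / (q ^ 2) ^ a) (q ^ 2) (a + b) =
      (-y) ^ a / q ^ (a * (a + 1)) * qPoch (q ^ 2 / y) (q ^ 2) a * qPoch y (q ^ 2) b := by
  induction a with
  | zero => simp
  | succ a ih =>
    rw [show a + 1 + b = a + b + 1 by ring, qPoch_succ',
      show y / (q ^ 2) ^ (a + 1) * q ^ 2 = y / (q ^ 2) ^ a by rw [pow_succ]; field_simp,
      ih, qPoch_succ, show (a + 1) * (a + 1 + 1) = a * (a + 1) + 2 * (a + 1) by ring,
      pow_add q (a * (a + 1)), pow_mul q 2, pow_succ (q ^ 2)]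
    field_simp
    ring

/-- The summand of the quintuple product series in base `r ^ 2`. -/
noncomputable def quintCoeff (r z : ℝ) (k : ℤ) : ℝ :=
  (-1) ^ k * (z ^ (3 * k) * r ^ (k * (3 * k - 1)) + z ^ (3 * k + 1) * r ^ (k * (3 * k + 1)))

/-- The factor by which the summand of the finite quintuple product identity, centred at `m`,
differs from the summand of the quintuple product series. -/
noncomputable def quintWeight (r z : ℝ) (m i a : ℕ) : ℝ :=
  qPoch (r ^ 2) (r ^ 2) (2 * m) * (qPoch (r ^ 2 / z) (r ^ 2) m * qPoch z (r ^ 2) (m + 1)) /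
    (qPoch (r ^ 2) (r ^ 2) i * qPoch (r ^ 2) (r ^ 2) a *
      (qPoch (r ^ 2 / z ^ 2) (r ^ 2) a * qPoch (z ^ 2) (r ^ 2) (i + 1)))

lemma quintTerm_div_pow {r z : ℝ} (hr : r ≠ 0) (hz : z ≠ 0) {m i a : ℕ} (h : i + a = 2 * m) :
    quintTerm (z / (r ^ 2) ^ m) (r ^ 2) (2 * m) i =
      quintCoeff r z ((i : ℤ) - m) * quintWeight r z m i a := by
  have h1 : qPoch (z / (r ^ 2) ^ m) (r ^ 2) (2 * m + 1) =
      (-z) ^ m / r ^ (m * (m + 1)) * qPoch (r ^ 2 / z) (r ^ 2) m * qPoch z (r ^ 2) (m + 1) := by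
    rw [show 2 * m + 1 = m + (m + 1) by ring]
    exact qPoch_div_pow hz hr m (m + 1)
  have h2 : (z / (r ^ 2) ^ m) ^ 2 * (r ^ 2) ^ i = z ^ 2 / (r ^ 2) ^ a := by
    rw [div_pow, ← pow_mul, mul_comm m 2, ← h, pow_add]
    field_simp
  have h3 : qPoch (z ^ 2 / (r ^ 2) ^ a) (r ^ 2) (2 * m + 1) =
      (-z ^ 2) ^ a / r ^ (a * (a + 1)) * qPoch (r ^ 2 / z ^ 2) (r ^ 2) a *
        qPoch (z ^ 2) (r ^ 2) (i + 1) := by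
    rw [show 2 * m + 1 = a + (i + 1) by omega]
    exact qPoch_div_pow (pow_ne_zero 2 hz) hr a (i + 1)
  have key : (1 + z / (r ^ 2) ^ m * (r ^ 2) ^ i) * (z / (r ^ 2) ^ m) ^ i * (r ^ 2) ^ i ^ 2 *
      ((-z) ^ m / r ^ (m * (m + 1))) =
      quintCoeff r z ((i : ℤ) - m) * ((-z ^ 2) ^ a / r ^ (a * (a + 1))) := by
    obtain ⟨k, hk⟩ : ∃ k : ℤ, k = (i : ℤ) - m := ⟨_, rfl⟩
    have hi : (i : ℤ) = m + k := by omega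
    have ha : (a : ℤ) = m - k := by omega
    have e1 : z / (r ^ 2) ^ m * (r ^ 2) ^ i = z * r ^ (2 * k) := by
      rw [zpow_mul, hk, zpow_sub₀ (by positivity)]
      simp only [zpow_natCast, zpow_ofNat]
      ring
    have e2 : (z / (r ^ 2) ^ m) ^ i * (r ^ 2) ^ i ^ 2 =
        z ^ ((m : ℤ) + k) * r ^ (2 * (m + k) * k) := by
      rw [← hi, hk, show 2 * (i : ℤ) * (i - m) = ((2 * i ^ 2 : ℕ) : ℤ) - ((2 * m * i : ℕ) : ℤ) by
        push_cast; ring, zpow_sub₀ hr, zpow_natCast, zpow_natCast, zpow_natCast, div_pow,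
        ← pow_mul, ← pow_mul, ← pow_mul]
      ring
    have e3 : (-z) ^ m / r ^ (m * (m + 1)) =
        (-1) ^ (m : ℤ) * z ^ (m : ℤ) * r ^ (-((m : ℤ) * (m + 1))) := by
      rw [show (m : ℤ) * (m + 1) = ((m * (m + 1) : ℕ) : ℤ) by push_cast; ring, zpow_neg,
        zpow_natCast, zpow_natCast, zpow_natCast, neg_pow z, div_eq_mul_inv]
    have e4 : (-z ^ 2) ^ a / r ^ (a * (a + 1)) =
        (-1) ^ ((m : ℤ) - k) * z ^ (2 * ((m : ℤ) - k)) * r ^ (-(((m : ℤ) - k) * (m - k + 1))) := by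
      rw [← ha, show (a : ℤ) * (a + 1) = ((a * (a + 1) : ℕ) : ℤ) by push_cast; ring, zpow_neg,
        zpow_mul, zpow_natCast, zpow_natCast, zpow_natCast, neg_pow (z ^ 2), div_eq_mul_inv,
        zpow_ofNat]
    have e5 : (-1 : ℝ) ^ k * (-1) ^ ((m : ℤ) - k) = (-1) ^ (m : ℤ) := by
      rw [← zpow_add₀ (by norm_num)]; congr 1; ring
    have ez : z ^ (3 * k) * z ^ (2 * ((m : ℤ) - k)) = z ^ ((m : ℤ) + k) * z ^ (m : ℤ) := by
      rw [← zpow_add₀ hz, ← zpow_add₀ hz]; congr 1; ring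
    have er : r ^ (k * (3 * k - 1)) * r ^ (-(((m : ℤ) - k) * (m - k + 1))) =
        r ^ (2 * (m + k) * k) * r ^ (-((m : ℤ) * (m + 1))) := by
      rw [← zpow_add₀ hr, ← zpow_add₀ hr]; congr 1; ring
    have er' : r ^ (k * (3 * k + 1)) = r ^ (k * (3 * k - 1)) * r ^ (2 * k) := by
      rw [← zpow_add₀ hr]; congr 1; ring
    rw [← hk, e1, e3, e4, quintCoeff, mul_assoc (1 + _), e2, ← e5, er', zpow_add₀ hz (3 * k),
      zpow_one]
    linear_combination (-(1 + z * r ^ (2 * k)) * (-1) ^ k * (-1) ^ ((m : ℤ) - k)) *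
      (r ^ (2 * (m + k) * k) * r ^ (-((m : ℤ) * (m + 1))) * ez +
        z ^ (3 * k) * z ^ (2 * ((m : ℤ) - k)) * er)
  rw [quintTerm, quintWeight, h1, h2, h3, show 2 * m - i = a by omega]
  have h4 : (-z ^ 2) ^ a / r ^ (a * (a + 1)) ≠ 0 :=
    div_ne_zero (pow_ne_zero _ (neg_ne_zero.mpr (pow_ne_zero 2 hz))) (pow_ne_zero _ hr)
  generalize (-z ^ 2) ^ a / r ^ (a * (a + 1)) = X at *
  generalize (-z) ^ m / r ^ (m * (m + 1)) = Y at *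
  conv_rhs => rw [← mul_div_assoc, ← mul_div_mul_left _ _ h4]
  congr 1
  · linear_combination (qPoch (r ^ 2) (r ^ 2) (2 * m) *
      (qPoch (r ^ 2 / z) (r ^ 2) m * qPoch z (r ^ 2) (m + 1))) * key
  · ring

lemma mul_pow_lt_one {a q : ℝ} (hq0 : 0 ≤ q) (ha0 : 0 ≤ a) (ha1 : a < 1) (hq1 : q ≤ 1) (i : ℕ) :
    a * q ^ i < 1 :=
  (mul_le_of_le_one_right ha0 (pow_le_one₀ hq0 hq1)).trans_lt ha1

lemma summable_norm_mul_pow (a : ℝ) {q : ℝ} (hq0 : 0 ≤ q) (hq1 : q < 1) :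
    Summable fun i : ℕ => ‖-(a * q ^ i)‖ := by
  simpa [abs_of_nonneg hq0] using (summable_geometric_of_lt_one hq0 hq1).mul_left |a|

lemma multipliable_qPochInf (a : ℝ) {q : ℝ} (hq0 : 0 ≤ q) (hq1 : q < 1) :
    Multipliable fun i : ℕ => 1 - a * q ^ i := by
  simpa [sub_eq_add_neg] using multipliable_one_add_of_summable (summable_norm_mul_pow a hq0 hq1)

lemma tendsto_qPoch (a : ℝ) {q : ℝ} (hq0 : 0 ≤ q) (hq1 : q < 1) :
    Tendsto (qPoch a q) atTop (𝓝 (qPochInf a q)) :=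
  (multipliable_qPochInf a hq0 hq1).hasProd.tendsto_prod_nat

lemma qPoch_pos {a q : ℝ} (hq0 : 0 ≤ q) (hq1 : q < 1) (ha0 : 0 ≤ a) (ha1 : a < 1) (n : ℕ) :
    0 < qPoch a q n :=
  prod_pos fun i _ => sub_pos.mpr (mul_pow_lt_one hq0 ha0 ha1 hq1.le i)

lemma qPoch_antitone {a q : ℝ} (hq0 : 0 ≤ q) (hq1 : q < 1) (ha0 : 0 ≤ a) (ha1 : a < 1) :
    Antitone (qPoch a q) := by
  refine antitone_nat_of_succ_le fun n => ?_
  rw [qPoch_succ]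
  refine mul_le_of_le_one_right (qPoch_pos hq0 hq1 ha0 ha1 n).le ?_
  linarith [mul_nonneg ha0 (pow_nonneg hq0 n)]

lemma qPochInf_le_qPoch {a q : ℝ} (hq0 : 0 ≤ q) (hq1 : q < 1) (ha0 : 0 ≤ a) (ha1 : a < 1)
    (n : ℕ) : qPochInf a q ≤ qPoch a q n :=
  (qPoch_antitone hq0 hq1 ha0 ha1).le_of_tendsto (tendsto_qPoch a hq0 hq1) n

lemma qPoch_le_one {a q : ℝ} (hq0 : 0 ≤ q) (hq1 : q < 1) (ha0 : 0 ≤ a) (ha1 : a < 1)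
    (n : ℕ) : qPoch a q n ≤ 1 := by
  simpa using qPoch_antitone hq0 hq1 ha0 ha1 (Nat.zero_le n)

lemma qPochInf_pos {a q : ℝ} (hq0 : 0 ≤ q) (hq1 : q < 1) (ha0 : 0 ≤ a) (ha1 : a < 1) :
    0 < qPochInf a q := by
  refine lt_of_le_of_ne (ge_of_tendsto' (tendsto_qPoch a hq0 hq1)
    fun n => (qPoch_pos hq0 hq1 ha0 ha1 n).le) (Ne.symm ?_)
  have h := tprod_one_add_ne_zero_of_summable (f := fun i : ℕ => -(a * q ^ i))
    (fun i => by linarith [mul_pow_lt_one hq0 ha0 ha1 hq1.le i] |> ne_of_gt)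
    (summable_norm_mul_pow a hq0 hq1)
  simpa [qPochInf, sub_eq_add_neg] using h

lemma summable_pow_natAbs {r : ℝ} (hr0 : 0 ≤ r) (hr1 : r < 1) :
    Summable fun k : ℤ => r ^ k.natAbs := by
  have := summable_geometric_of_lt_one hr0 hr1
  exact summable_int_iff_summable_nat_and_neg.mpr ⟨by simpa using this, by simpa using this⟩

lemma norm_quintCoeff_le {r z : ℝ} (hr0 : 0 < r) (hrz : r < z) (hz1 : z < 1) (k : ℤ) :
    ‖quintCoeff r z k‖ ≤ 2 * r⁻¹ ^ 2 * r ^ k.natAbs := by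
  have hr1 : r < 1 := hrz.trans hz1
  have hz0 : 0 < z := hr0.trans hrz
  have bound (a b : ℤ) (h0 : |k| - 2 ≤ b) (h1 : |k| - 2 ≤ a + b) :
      z ^ a * r ^ b ≤ r⁻¹ ^ 2 * r ^ k.natAbs := by
    have e : r⁻¹ ^ 2 * r ^ k.natAbs = r ^ (|k| - 2) := by
      rw [zpow_sub₀ hr0.ne', Int.abs_eq_natAbs, zpow_natCast, zpow_ofNat]
      field_simp
    rw [e]
    rcases le_total 0 a with ha | ha
    · calc z ^ a * r ^ b ≤ 1 * r ^ b := by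
            gcongr
            exact zpow_le_one₀ hz0 hz1.le ha
        _ ≤ _ := by rw [one_mul]; exact zpow_le_zpow_right_of_le_one₀ hr0 hr1.le h0
    · calc z ^ a * r ^ b ≤ r ^ a * r ^ b := by
            gcongr ?_ * _
            obtain ⟨n, rfl⟩ := Int.exists_eq_neg_ofNat ha
            rw [zpow_neg, zpow_neg, zpow_natCast, zpow_natCast]
            gcongr
        _ ≤ _ := by
            rw [← zpow_add₀ hr0.ne']; exact zpow_le_zpow_right_of_le_one₀ hr0 hr1.le h1
  have habs : |k| ≤ k ^ 2 := by
    rcases abs_cases k with ⟨h, _⟩ | ⟨h, _⟩ <;> rw [h] <;> nlinarith [sq_nonneg k]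
  rw [quintCoeff, norm_mul, norm_zpow, norm_neg, norm_one, one_zpow, one_mul, Real.norm_eq_abs,
    abs_of_nonneg (by positivity), mul_assoc, two_mul]
  refine add_le_add (bound _ _ ?_ ?_) (bound _ _ ?_ ?_) <;>
  rcases abs_cases k with ⟨h, _⟩ | ⟨h, _⟩ <;> nlinarith [sq_nonneg (k + 1)]

lemma sum_Icc_quintCoeff_mul_quintWeight {r z : ℝ} (hr0 : 0 < r) (hrz : r < z) (hz1 : z < 1)
    (m : ℕ) :
    ∑ k ∈ Icc (-(m : ℤ)) m, quintCoeff r z k * quintWeight r z m (m + k).toNat (m - k).toNat =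
      1 := by
  have hr1 : r < 1 := hrz.trans hz1
  have hz0 : 0 < z := hr0.trans hrz
  have hq (i : ℕ) : r ^ 2 * (r ^ 2) ^ i ≠ 1 := by
    rw [← pow_succ', ← pow_mul]
    exact (pow_lt_one₀ hr0.le hr1 (by omega)).ne
  have hlt (y : ℝ) (hy0 : r ^ 2 < y) (hy1 : y < 1) (a i : ℕ) :
      y / (r ^ 2) ^ a * (r ^ 2) ^ i ≠ 1 := by
    rcases le_or_gt a i with h | h
    · obtain ⟨d, rfl⟩ := Nat.exists_eq_add_of_le h
      rw [pow_add, ← mul_assoc, div_mul_cancel₀ _ (by positivity)]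
      exact (mul_pow_lt_one (by positivity) (by nlinarith) hy1
        (pow_le_one₀ hr0.le hr1.le) d).ne
    · obtain ⟨d, rfl⟩ := Nat.exists_eq_add_of_lt h
      rw [show i + d + 1 = d + 1 + i by ring, pow_add, ← div_div,
        div_mul_cancel₀ _ (by positivity), Ne, div_eq_one_iff_eq (by positivity), pow_succ]
      have := mul_le_of_le_one_left (sq_nonneg r)
        (pow_le_one₀ (n := d) (sq_nonneg r) (pow_le_one₀ (n := 2) hr0.le hr1.le))
      exact (this.trans_lt hy0).ne'
  rw [← sum_range_quintTerm (z := z / (r ^ 2) ^ m) (q := r ^ 2) hq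
    (hlt z (by nlinarith) hz1 m) (fun i => by
      rw [div_pow, ← pow_mul]
      exact hlt (z ^ 2) (by nlinarith) (by nlinarith) _ i) (2 * m)]
  refine sum_nbij' (fun k => (m + k).toNat) (fun i => (i : ℤ) - m) ?_ ?_ ?_ ?_ ?_
  · intro k hk; simp only [mem_Icc, mem_range] at *; omega
  · intro i hi; simp only [mem_Icc, mem_range] at *; omega
  · intro k hk; simp only [mem_Icc] at *; omega
  · intro i hi; simp only [mem_range] at *; omega
  · intro k hk
    simp only [mem_Icc] at hk
    rw [quintTerm_div_pow hr0.ne' hz0.ne' (a := (m - k).toNat) (by omega)]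
    congr 2
    omega

/-- The quintuple product identity, in base `r ^ 2`. -/
theorem hasSum_quintCoeff {r z : ℝ} (hr0 : 0 < r) (hrz : r < z) (hz1 : z < 1) :
    HasSum (quintCoeff r z)
      (qPochInf (r ^ 2) (r ^ 2) * qPochInf (z ^ 2) (r ^ 2) * qPochInf (r ^ 2 / z ^ 2) (r ^ 2) /
        (qPochInf z (r ^ 2) * qPochInf (r ^ 2 / z) (r ^ 2))) := by
  have hr1 : r < 1 := hrz.trans hz1
  have hz0 : 0 < z := hr0.trans hrz
  have q0 : 0 ≤ r ^ 2 := sq_nonneg r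
  have q1 : r ^ 2 < 1 := pow_lt_one₀ hr0.le hr1 two_ne_zero
  have z20 : 0 ≤ z ^ 2 := sq_nonneg z
  have z21 : z ^ 2 < 1 := pow_lt_one₀ hz0.le hz1 two_ne_zero
  have w0 : 0 ≤ r ^ 2 / z := by positivity
  have w1 : r ^ 2 / z < 1 := (div_lt_one hz0).mpr (by nlinarith)
  have w20 : 0 ≤ r ^ 2 / z ^ 2 := by positivity
  have w21 : r ^ 2 / z ^ 2 < 1 := (div_lt_one (by positivity)).mpr (by nlinarith)
  have Pq := qPochInf_pos q0 q1 q0 q1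
  have Pz := qPochInf_pos q0 q1 hz0.le hz1
  have Pw := qPochInf_pos q0 q1 w0 w1
  have Pz2 := qPochInf_pos q0 q1 z20 z21
  have Pw2 := qPochInf_pos q0 q1 w20 w21
  let f (m : ℕ) (k : ℤ) : ℝ :=
    if k ∈ Icc (-(m : ℤ)) m then
      quintCoeff r z k * quintWeight r z m (m + k).toNat (m - k).toNat
    else 0
  let C : ℝ := 1 / (qPochInf (r ^ 2) (r ^ 2) * qPochInf (r ^ 2) (r ^ 2) *
      (qPochInf (r ^ 2 / z ^ 2) (r ^ 2) * qPochInf (z ^ 2) (r ^ 2)))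
  let L : ℝ := qPochInf (r ^ 2) (r ^ 2) * (qPochInf (r ^ 2 / z) (r ^ 2) * qPochInf z (r ^ 2)) /
      (qPochInf (r ^ 2) (r ^ 2) * qPochInf (r ^ 2) (r ^ 2) *
        (qPochInf (r ^ 2 / z ^ 2) (r ^ 2) * qPochInf (z ^ 2) (r ^ 2)))
  have hsum : Summable fun k : ℤ => 2 * r⁻¹ ^ 2 * r ^ k.natAbs :=
    (summable_pow_natAbs hr0.le hr1).mul_left _
  have hC : 0 ≤ C := by positivity
  have hweight (m i a : ℕ) : ‖quintWeight r z m i a‖ ≤ C := by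
    have p1 := qPoch_pos q0 q1 q0 q1
    have p2 := qPoch_pos q0 q1 hz0.le hz1
    have p3 := qPoch_pos q0 q1 w0 w1
    have p4 := qPoch_pos q0 q1 z20 z21
    have p5 := qPoch_pos q0 q1 w20 w21
    have hnum : qPoch (r ^ 2) (r ^ 2) (2 * m) *
        (qPoch (r ^ 2 / z) (r ^ 2) m * qPoch z (r ^ 2) (m + 1)) ≤ 1 :=
      mul_le_one₀ (qPoch_le_one q0 q1 q0 q1 _) (mul_pos (p3 _) (p2 _)).le
        (mul_le_one₀ (qPoch_le_one q0 q1 w0 w1 _) (p2 _).le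
          (qPoch_le_one q0 q1 hz0.le hz1 _))
    rw [Real.norm_of_nonneg]
    · refine div_le_div₀ zero_le_one hnum (by positivity) ?_
      gcongr
      · exact (mul_pos (p1 _) (p1 _)).le
      · exact (p1 _).le
      · exact qPochInf_le_qPoch q0 q1 q0 q1 _
      · exact qPochInf_le_qPoch q0 q1 q0 q1 _
      · exact (p5 _).le
      · exact qPochInf_le_qPoch q0 q1 w20 w21 _
      · exact qPochInf_le_qPoch q0 q1 z20 z21 _
    · exact (div_pos (mul_pos (p1 _) (mul_pos (p3 _) (p2 _)))
        (mul_pos (mul_pos (p1 _) (p1 _)) (mul_pos (p5 _) (p4 _)))).le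
  have hlim := tendsto_tsum_of_dominated_convergence (𝓕 := atTop) (f := f)
    (g := fun k => quintCoeff r z k * L) (hsum.mul_right C) ?_ ?_
  · have hf (m : ℕ) : ∑' k, f m k = 1 := by
      rw [tsum_eq_sum (s := Icc (-(m : ℤ)) m) fun k hk => if_neg hk,
        ← sum_Icc_quintCoeff_mul_quintWeight hr0 hrz hz1 m]
      exact sum_congr rfl fun k hk => if_pos hk
    simp only [hf, tsum_mul_right] at hlim
    have h1 := tendsto_nhds_unique hlim tendsto_const_nhds
    have hs : Summable (quintCoeff r z) :=
      hsum.of_norm_bounded (norm_quintCoeff_le hr0 hrz hz1)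
    convert hs.hasSum using 1
    have hL : L ≠ 0 := by positivity
    rw [eq_div_of_mul_eq hL h1]
    simp only [L]
    field_simp
  · intro k
    have e : (fun m : ℕ => quintCoeff r z k * quintWeight r z m (m + k).toNat (m - k).toNat)
        =ᶠ[atTop] (f · k) := by
      filter_upwards [eventually_ge_atTop k.natAbs] with m hm
      exact (if_pos (by rw [mem_Icc]; omega)).symm
    refine Tendsto.congr' e (Tendsto.const_mul _ ?_)
    have t1 : Tendsto (fun m : ℕ => (m + k).toNat) atTop atTop :=
      tendsto_atTop.mpr fun b => by
        filter_upwards [eventually_ge_atTop (b + k.natAbs)] with m hm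
        omega
    have t2 : Tendsto (fun m : ℕ => (m - k).toNat) atTop atTop :=
      tendsto_atTop.mpr fun b => by
        filter_upwards [eventually_ge_atTop (b + k.natAbs)] with m hm
        omega
    have t3 : Tendsto (fun m : ℕ => 2 * m) atTop atTop :=
      tendsto_atTop.mpr fun b => by
        filter_upwards [eventually_ge_atTop b] with m hm
        omega
    have tq (a : ℝ) := tendsto_qPoch a q0 q1
    refine Tendsto.div (((tq _).comp t3).mul ((tq _).mul ((tq _).comp (tendsto_add_atTop_nat 1))))
      ((((tq _).comp t1).mul ((tq _).comp t2)).mul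
        (((tq _).comp t2).mul ((tq _).comp ((tendsto_add_atTop_nat 1).comp t1)))) ?_
    positivity
  · refine Eventually.of_forall fun m k => ?_
    simp only [f]
    split_ifs
    · rw [norm_mul]
      exact mul_le_mul (norm_quintCoeff_le hr0 hrz hz1 k) (hweight _ _ _) (norm_nonneg _)
        (by positivity)
    · rw [norm_zero]
      positivity

lemma qPochInf_eq_even_mul_odd (a : ℝ) {q : ℝ} (hq0 : 0 ≤ q) (hq1 : q < 1) :
    qPochInf a q = qPochInf a (q ^ 2) * qPochInf (a * q) (q ^ 2) := by
  have h0 : q ^ 2 < 1 := pow_lt_one₀ hq0 hq1 two_ne_zero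
  have he := (multipliable_qPochInf a (sq_nonneg q) h0).hasProd
  have ho := (multipliable_qPochInf (a * q) (sq_nonneg q) h0).hasProd
  refine HasProd.tprod_eq (HasProd.even_mul_odd ?_ ?_)
  · simp only [pow_mul]
    exact he
  · simp only [pow_succ' q (2 * _), pow_mul, ← mul_assoc]
    exact ho

lemma qPoch_five_mul (a q : ℝ) (n : ℕ) :
    qPoch a q (5 * n) = qPoch a (q ^ 5) n * qPoch (a * q) (q ^ 5) n * qPoch (a * q ^ 2) (q ^ 5) n *
      qPoch (a * q ^ 3) (q ^ 5) n * qPoch (a * q ^ 4) (q ^ 5) n := by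
  induction n with
  | zero => simp
  | succ n ih =>
    rw [show 5 * (n + 1) = 5 * n + 1 + 1 + 1 + 1 + 1 by ring]
    simp only [qPoch_succ, ih, ← pow_mul]
    ring

lemma qPochInf_eq_five (a : ℝ) {q : ℝ} (hq0 : 0 ≤ q) (hq1 : q < 1) :
    qPochInf a q = qPochInf a (q ^ 5) * qPochInf (a * q) (q ^ 5) * qPochInf (a * q ^ 2) (q ^ 5) *
      qPochInf (a * q ^ 3) (q ^ 5) * qPochInf (a * q ^ 4) (q ^ 5) := by
  have h0 : 0 ≤ q ^ 5 := by positivity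
  have h1 : q ^ 5 < 1 := pow_lt_one₀ hq0 hq1 (by norm_num)
  have t (b : ℝ) := tendsto_qPoch b h0 h1
  refine tendsto_nhds_unique ((tendsto_qPoch a hq0 hq1).comp
    (tendsto_id.const_mul_atTop' (r := 5) (by norm_num))) ?_
  simpa only [Function.comp_def, id, qPoch_five_mul] using
    ((((t a).mul (t _)).mul (t _)).mul (t _)).mul (t _)

lemma eulerProd_eq_qPochInf (q : ℝ) : eulerProd q = qPochInf q q := by
  simp only [eulerProd, qPochInf, pow_succ']

/-- A sum over `ℤ` grouped into the pairs of indices `-2k` and `-2k - 1`. -/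
lemma tsum_neg_even_add_neg_odd {t : ℤ → ℝ} (ht : Summable t) :
    ∑' k : ℤ, (t (-(2 * k)) + t (-(2 * k + 1))) = ∑' k, t k := by
  have hu : Summable fun k => t (-k) := (Equiv.neg ℤ).summable_iff.mpr ht
  have i1 : Function.Injective fun k : ℤ => 2 * k := fun a b h => by dsimp only at h; omega
  have i2 : Function.Injective fun k : ℤ => 2 * k + 1 := fun a b h => by dsimp only at h; omega
  have he := (hu.comp_injective i1).hasSum
  have ho := (hu.comp_injective i2).hasSum
  have hall : HasSum (fun k => t (-k))
      (∑' k : ℤ, t (-(2 * k)) + ∑' k : ℤ, t (-(2 * k + 1))) := by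
    refine (i1.hasSum_range_iff.mpr he).add_isCompl ?_ (i2.hasSum_range_iff.mpr ho)
    have r1 : Set.range (fun k : ℤ => 2 * k) = {n | Even n} := by
      ext n; simp [even_iff_exists_two_mul]
    have r2 : Set.range (fun k : ℤ => 2 * k + 1) = {n | Odd n} := by
      ext n; simp [Odd]
    rw [r1, r2]
    exact Int.isCompl_even_odd
  rw [← (Equiv.neg ℤ).tsum_eq t]
  exact (he.add ho).tsum_eq.trans hall.tsum_eq.symm

lemma quintCoeff_pow_five_neg_even {x : ℝ} (hx : x ≠ 0) (k : ℤ) :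
    quintCoeff (x ^ 5) x (-(2 * k)) = (x ^ 2) ^ (30 * k ^ 2 + 2 * k) +
      x * (x ^ 2) ^ (30 * k ^ 2 - 8 * k) := by
  rw [quintCoeff, Even.neg_one_zpow (by simp), one_mul]
  simp only [← zpow_natCast, ← zpow_mul]
  nth_rw 6 [← zpow_one x]
  simp only [← zpow_add₀ hx]
  congr 2 <;> push_cast <;> ring

lemma quintCoeff_pow_five_neg_odd {x : ℝ} (hx : x ≠ 0) (k : ℤ) :
    quintCoeff (x ^ 5) x (-(2 * k + 1)) = -((x ^ 2) ^ (30 * k ^ 2 + 22 * k + 4) +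
      x * (x ^ 2) ^ (30 * k ^ 2 + 32 * k + 8)) := by
  rw [quintCoeff, Odd.neg_one_zpow (odd_two_mul_add_one k).neg, neg_one_mul, add_comm]
  simp only [← zpow_natCast, ← zpow_mul]
  nth_rw 6 [← zpow_one x]
  simp only [← zpow_add₀ hx]
  congr 3 <;> push_cast <;> ring

lemma tsum_minChar_add {x : ℝ} (hx0 : 0 < x) (hx1 : x < 1) :
    (∑' k : ℤ, ((x ^ 2) ^ (30 * k ^ 2 + 2 * k) - (x ^ 2) ^ (30 * k ^ 2 + 22 * k + 4))) +
      x * ∑' k : ℤ, ((x ^ 2) ^ (30 * k ^ 2 - 8 * k) - (x ^ 2) ^ (30 * k ^ 2 + 32 * k + 8)) =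
      ∑' k : ℤ, quintCoeff (x ^ 5) x k := by
  have hs : Summable (quintCoeff (x ^ 5) x) :=
    (hasSum_quintCoeff (by positivity) (pow_lt_self_of_lt_one₀ hx0 hx1 (by norm_num)) hx1).summable
  have i1 : Function.Injective fun k : ℤ => -(2 * k) := fun a b h => by dsimp only at h; omega
  have i2 : Function.Injective fun k : ℤ => -(2 * k + 1) := fun a b h => by
    dsimp only at h; omega
  have he := hs.comp_injective i1
  have ho := (hs.comp_injective i2).neg
  simp only [Function.comp_def, quintCoeff_pow_five_neg_even hx0.ne',
    quintCoeff_pow_five_neg_odd hx0.ne', neg_neg] at he ho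
  have p (n : ℤ) : 0 ≤ (x ^ 2) ^ n := by positivity
  have p' (n : ℤ) : 0 ≤ x * (x ^ 2) ^ n := by positivity
  have s1 : Summable fun k : ℤ => (x ^ 2) ^ (30 * k ^ 2 + 2 * k) :=
    Summable.of_nonneg_of_le (fun _ => p _) (fun _ => le_add_of_nonneg_right (p' _)) he
  have s2 : Summable fun k : ℤ => x * (x ^ 2) ^ (30 * k ^ 2 - 8 * k) :=
    Summable.of_nonneg_of_le (fun _ => p' _) (fun _ => le_add_of_nonneg_left (p _)) he
  have s3 : Summable fun k : ℤ => (x ^ 2) ^ (30 * k ^ 2 + 22 * k + 4) :=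
    Summable.of_nonneg_of_le (fun _ => p _) (fun _ => le_add_of_nonneg_right (p' _)) ho
  have s4 : Summable fun k : ℤ => x * (x ^ 2) ^ (30 * k ^ 2 + 32 * k + 8) :=
    Summable.of_nonneg_of_le (fun _ => p' _) (fun _ => le_add_of_nonneg_left (p _)) ho
  rw [← tsum_mul_left, ← tsum_neg_even_add_neg_odd hs]
  simp only [mul_sub]
  rw [← (s1.sub s3).tsum_add (s2.sub s4)]
  refine tsum_congr fun k => ?_
  rw [quintCoeff_pow_five_neg_even hx0.ne', quintCoeff_pow_five_neg_odd hx0.ne']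
  ring

lemma tprod_rogersRamanujan {x : ℝ} (hx0 : 0 < x) (hx1 : x < 1) :
    ∏' n : ℕ, ((1 - x * (x ^ 5) ^ n) * (1 - x ^ 4 * (x ^ 5) ^ n))⁻¹ =
      (qPochInf x (x ^ 5) * qPochInf (x ^ 4) (x ^ 5))⁻¹ := by
  have h0 : 0 ≤ x ^ 5 := by positivity
  have h1 : x ^ 5 < 1 := pow_lt_one₀ hx0.le hx1 (by norm_num)
  have p1 := qPochInf_pos h0 h1 hx0.le hx1
  have p2 := qPochInf_pos h0 h1 (by positivity) (pow_lt_one₀ hx0.le hx1 (by norm_num : 4 ≠ 0))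
  exact (((multipliable_qPochInf x h0 h1).hasProd.mul
    (multipliable_qPochInf (x ^ 4) h0 h1).hasProd).inv₀ (mul_pos p1 p2).ne').tprod_eq

lemma eulerProd_inv_mul_tsum_quintCoeff {x : ℝ} (hx0 : 0 < x) (hx1 : x < 1) :
    (eulerProd (x ^ 2))⁻¹ * ∑' k : ℤ, quintCoeff (x ^ 5) x k =
      (qPochInf x (x ^ 5) * qPochInf (x ^ 4) (x ^ 5))⁻¹ := by
  have h0 : 0 ≤ x ^ 5 := by positivity
  have h1 : x ^ 5 < 1 := pow_lt_one₀ hx0.le hx1 (by norm_num)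
  have pos (n : ℕ) (hn : n ≠ 0) : qPochInf (x ^ n) (x ^ 10) ≠ 0 :=
    (qPochInf_pos (by positivity) (pow_lt_one₀ hx0.le hx1 (by norm_num)) (by positivity)
      (pow_lt_one₀ hx0.le hx1 hn)).ne'
  have e8 : (x ^ 5) ^ 2 / x ^ 2 = x ^ 8 := by field_simp
  have e9 : (x ^ 5) ^ 2 / x = x ^ 9 := by field_simp
  rw [(hasSum_quintCoeff (r := x ^ 5) (by positivity)
      (pow_lt_self_of_lt_one₀ hx0 hx1 (by norm_num)) hx1).tsum_eq, e8, e9, eulerProd_eq_qPochInf,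
    qPochInf_eq_five _ (sq_nonneg x) (pow_lt_one₀ hx0.le hx1 two_ne_zero),
    qPochInf_eq_even_mul_odd x h0 h1, qPochInf_eq_even_mul_odd (x ^ 4) h0 h1]
  have p1 := pos 1 one_ne_zero
  rw [pow_one] at p1
  simp only [← pow_mul, ← pow_add, ← pow_succ', Nat.reduceMul, Nat.reduceAdd]
  have p2 := pos 2 (by norm_num)
  have p4 := pos 4 (by norm_num)
  have p6 := pos 6 (by norm_num)
  have p8 := pos 8 (by norm_num)
  have p9 := pos 9 (by norm_num)
  have p10 := pos 10 (by norm_num)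
  field_simp

theorem twisted_character_one_fortieth_product_form (q : ℝ) (hq0 : 0 < q) (hq1 : q < 1) :
    minChar 5 6 2 2 q + minChar 5 6 2 4 q =
      q ^ (-(1 : ℝ) / 120) *
        ∏' n : ℕ, ((1 - q ^ ((5 * (n : ℝ) + 1) / 2)) * (1 - q ^ ((5 * (n : ℝ) + 4) / 2)))⁻¹ := by
  obtain ⟨x, hx0, rfl⟩ : ∃ x : ℝ, 0 < x ∧ x ^ 2 = q :=
    ⟨√q, Real.sqrt_pos.mpr hq0, Real.sq_sqrt hq0.le⟩
  have hx1 : x < 1 := by nlinarith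
  have hexp (n j : ℕ) : (x ^ 2) ^ ((5 * (n : ℝ) + j) / 2) = x ^ j * (x ^ 5) ^ n := by
    rw [← Real.rpow_natCast x 2, ← Real.rpow_mul hx0.le, Nat.cast_ofNat,
      mul_div_cancel₀ _ two_ne_zero, ← pow_mul, ← pow_add, ← Real.rpow_natCast x (j + 5 * n)]
    congr 1
    push_cast
    ring
  have hprod (n : ℕ) : ((1 - (x ^ 2) ^ ((5 * (n : ℝ) + 1) / 2)) *
      (1 - (x ^ 2) ^ ((5 * (n : ℝ) + 4) / 2)))⁻¹ =
      ((1 - x * (x ^ 5) ^ n) * (1 - x ^ 4 * (x ^ 5) ^ n))⁻¹ := by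
    have h1 := hexp n 1
    have h4 := hexp n 4
    rw [Nat.cast_one, pow_one] at h1
    rw [Nat.cast_ofNat] at h4
    rw [h1, h4]
  have hhalf : (x ^ 2) ^ (-(1 : ℝ) / 120 + 1 / 2) = (x ^ 2) ^ (-(1 : ℝ) / 120) * x := by
    rw [Real.rpow_add (by positivity), ← Real.sqrt_eq_rpow, Real.sqrt_sq hx0.le]
  have m2 : minChar 5 6 2 2 (x ^ 2) = (x ^ 2) ^ (-(1 : ℝ) / 120) * (eulerProd (x ^ 2))⁻¹ *
      ∑' k : ℤ, ((x ^ 2) ^ (30 * k ^ 2 + 2 * k) - (x ^ 2) ^ (30 * k ^ 2 + 22 * k + 4)) := by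
    rw [minChar]
    congr 2
    · norm_num
    · norm_num [mul_comm]
  have m4 : minChar 5 6 2 4 (x ^ 2) = (x ^ 2) ^ (-(1 : ℝ) / 120) * x * (eulerProd (x ^ 2))⁻¹ *
      ∑' k : ℤ, ((x ^ 2) ^ (30 * k ^ 2 - 8 * k) - (x ^ 2) ^ (30 * k ^ 2 + 32 * k + 8)) := by
    rw [minChar, ← hhalf]
    congr 2
    · norm_num
    · norm_num [mul_comm, sub_eq_add_neg]
  simp only [hprod]
  rw [tprod_rogersRamanujan hx0 hx1, ← eulerProd_inv_mul_tsum_quintCoeff hx0 hx1,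
    ← tsum_minChar_add hx0 hx1, m2, m4]
  ring
end

section
/- For every real number q with 0 < q < 1, the τ-twisted character of the W₃(4/5)-module W(2/5) has the Rogers–Ramanujan product form: χ_{5,6}^{1,1}(q) − χ_{5,6}^{1,5}(q) = q^{−1/30} · ∏_{n=0}^∞ 1/((1 − q^{10n+2})(1 − q^{10n+8})). -/
open scoped BigOperators

open Filter Topology

/-- The reciprocal `1 / (p; p)_m` for `m : ℤ`, equal to `0` when `m < 0`. -/
noncomputable def invPochhammer (p : ℝ) (m : ℤ) : ℝ :=
  if 0 ≤ m then (∏ i ∈ Finset.range m.toNat, (1 - p ^ (i + 1)))⁻¹ else 0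

lemma invPochhammer_natCast (p : ℝ) (n : ℕ) :
    invPochhammer p n = (∏ i ∈ Finset.range n, (1 - p ^ (i + 1)))⁻¹ := by
  simp [invPochhammer]

lemma one_sub_pow_succ_pos {p : ℝ} (hp0 : 0 < p) (hp1 : p < 1) (n : ℕ) :
    0 < 1 - p ^ (n + 1) :=
  sub_pos.2 (pow_lt_one₀ hp0.le hp1 n.succ_ne_zero)

lemma invPochhammer_sub_one {p : ℝ} (hp0 : 0 < p) (hp1 : p < 1) (m : ℤ) :
    invPochhammer p (m - 1) = (1 - p ^ m) * invPochhammer p m := by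
  rcases lt_trichotomy m 0 with hm | rfl | hm
  · rw [invPochhammer, invPochhammer, if_neg (by omega), if_neg (by omega), mul_zero]
  · simp [invPochhammer]
  · obtain ⟨n, rfl⟩ : ∃ n : ℕ, m = n + 1 := ⟨(m - 1).toNat, by omega⟩
    have h := (one_sub_pow_succ_pos hp0 hp1 n).ne'
    rw [add_sub_cancel_right, ← Nat.cast_succ, invPochhammer_natCast, invPochhammer_natCast,
      Finset.prod_range_succ, zpow_natCast]
    have h' : ∏ i ∈ Finset.range n, (1 - p ^ (i + 1)) ≠ 0 :=
      Finset.prod_ne_zero_iff.2 fun i _ => (one_sub_pow_succ_pos hp0 hp1 i).ne'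
    rw [Nat.succ_eq_add_one]
    field_simp

/-- The central Gaussian binomial coefficient `[2N, N + k]` in base `p`. -/
noncomputable def centralGaussBinom (p : ℝ) (N : ℕ) (k : ℤ) : ℝ :=
  (∏ i ∈ Finset.range (2 * N), (1 - p ^ (i + 1))) *
    (invPochhammer p (N - k) * invPochhammer p (N + k))

lemma centralGaussBinom_succ {p : ℝ} (hp0 : 0 < p) (hp1 : p < 1) (N : ℕ) (k : ℤ) :
    centralGaussBinom p (N + 1) k =
      (1 + p ^ (2 * N + 1)) * centralGaussBinom p N k +
        p ^ (N + 1 - k : ℤ) * centralGaussBinom p N (k - 1) +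
        p ^ (N + 1 + k : ℤ) * centralGaussBinom p N (k + 1) := by
  have hp := hp0.ne'
  have step := invPochhammer_sub_one hp0 hp1
  have e₁ := step (N + 1 - k)
  have e₂ := step (N + 1 + k)
  have e₃ := step (N - k)
  have e₄ := step (N + k)
  rw [show (N + 1 - k - 1 : ℤ) = N - k by ring] at e₁
  rw [show (N + 1 + k - 1 : ℤ) = N + k by ring] at e₂
  have a : p ^ (N + 1 - k : ℤ) = p ^ (N - k : ℤ) * p := by
    rw [← zpow_add_one₀ hp]; ring_nf
  have b : p ^ (N + 1 + k : ℤ) = p ^ (N + k : ℤ) * p := by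
    rw [← zpow_add_one₀ hp]; ring_nf
  have u : p ^ (2 * N) = p ^ (N - k : ℤ) * p ^ (N + k : ℤ) := by
    rw [← zpow_add₀ hp, ← zpow_natCast]; congr 1; push_cast; ring
  simp only [centralGaussBinom]
  rw [show 2 * (N + 1) = 2 * N + 1 + 1 by ring, Finset.prod_range_succ, Finset.prod_range_succ]
  rw [show ((N : ℤ) - (k - 1)) = N + 1 - k by ring, show ((N : ℤ) + (k - 1)) = N + k - 1 by ring,
    show ((N : ℤ) - (k + 1)) = N - k - 1 by ring, show ((N : ℤ) + (k + 1)) = N + 1 + k by ring,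
    Nat.cast_succ, e₃, e₄, e₁, e₂, a, b]
  simp only [pow_succ, u]
  ring

lemma centralGaussBinom_zero (p : ℝ) (k : ℤ) :
    centralGaussBinom p 0 k = if k = 0 then 1 else 0 := by
  rcases lt_trichotomy k 0 with hk | rfl | hk
  · simp [centralGaussBinom, invPochhammer, hk.not_ge, hk.ne]
  · simp [centralGaussBinom, invPochhammer]
  · simp [centralGaussBinom, invPochhammer, hk.not_ge, hk.ne']

/-- Finite form of the Jacobi triple product. -/
lemma hasSum_finite_jacobi {r : ℝ} (hr0 : 0 < r) (hr1 : r < 1) {z : ℝ} (hz : z ≠ 0) (N : ℕ) :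
    HasSum (fun k : ℤ => z ^ k * r ^ (k ^ 2) * centralGaussBinom (r ^ 2) N k)
      (∏ i ∈ Finset.range N, ((1 + z * r ^ (2 * i + 1)) * (1 + z⁻¹ * r ^ (2 * i + 1)))) := by
  have hr := hr0.ne'
  induction N with
  | zero =>
    convert! hasSum_single (f := fun k : ℤ => z ^ k * r ^ (k ^ 2) * centralGaussBinom (r ^ 2) 0 k)
      0 fun k hk => by simp [centralGaussBinom_zero, hk] using 1
    simp [centralGaussBinom_zero]
  | succ N ih =>
    rw [Finset.prod_range_succ]
    have ih₁ := (Equiv.subRight (1 : ℤ)).hasSum_iff.2 ih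
    have ih₂ := (Equiv.addRight (1 : ℤ)).hasSum_iff.2 ih
    have h := ((ih.mul_left (1 + (r ^ 2) ^ (2 * N + 1))).add
      (ih₁.mul_left (z * r ^ (2 * N + 1)))).add (ih₂.mul_left (z⁻¹ * r ^ (2 * N + 1)))
    convert! h using 1
    · ext k
      have hp0 : 0 < r ^ 2 := by positivity
      have hp1 : r ^ 2 < 1 := pow_lt_one₀ hr0.le hr1 two_ne_zero
      rw [centralGaussBinom_succ hp0 hp1]
      have e₁ : r ^ (k ^ 2) * (r ^ 2) ^ (N + 1 - k : ℤ) =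
          r ^ (2 * N + 1) * r ^ ((k - 1) ^ 2) := by
        rw [← zpow_natCast r 2, ← zpow_natCast r (2 * N + 1), ← zpow_mul, ← zpow_add₀ hr,
          ← zpow_add₀ hr]
        congr 1; push_cast; ring
      have e₂ : r ^ (k ^ 2) * (r ^ 2) ^ (N + 1 + k : ℤ) =
          r ^ (2 * N + 1) * r ^ ((k + 1) ^ 2) := by
        rw [← zpow_natCast r 2, ← zpow_natCast r (2 * N + 1), ← zpow_mul, ← zpow_add₀ hr,
          ← zpow_add₀ hr]
        congr 1; push_cast; ring
      have z₁ : z ^ k = z * z ^ (k - 1) := by rw [← zpow_one_add₀ hz]; ring_nf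
      have z₂ : z ^ k = z⁻¹ * z ^ (k + 1) := by rw [zpow_add_one₀ hz]; field_simp
      simp only [Function.comp, Equiv.subRight_apply, Equiv.coe_addRight]
      linear_combination (z ^ k * centralGaussBinom (r ^ 2) N (k - 1)) * e₁ +
        (z ^ k * centralGaussBinom (r ^ 2) N (k + 1)) * e₂ +
        (r ^ (2 * N + 1) * r ^ ((k - 1) ^ 2) * centralGaussBinom (r ^ 2) N (k - 1)) * z₁ +
        (r ^ (2 * N + 1) * r ^ ((k + 1) ^ 2) * centralGaussBinom (r ^ 2) N (k + 1)) * z₂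
    · field_simp
      ring

/-- The infinite `q`-Pochhammer symbol `(a; p)_∞`. -/
noncomputable def qPochhammer (a p : ℝ) : ℝ := ∏' n : ℕ, (1 - a * p ^ n)

lemma summable_norm_neg_mul_pow (a : ℝ) {p : ℝ} (hp0 : 0 < p) (hp1 : p < 1) :
    Summable fun n : ℕ => ‖-(a * p ^ n)‖ := by
  simpa [abs_of_pos hp0] using (summable_geometric_of_lt_one hp0.le hp1).mul_left |a|

lemma hasProd_qPochhammer (a : ℝ) {p : ℝ} (hp0 : 0 < p) (hp1 : p < 1) :
    HasProd (fun n : ℕ => 1 - a * p ^ n) (qPochhammer a p) := by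
  have := multipliable_one_add_of_summable (summable_norm_neg_mul_pow a hp0 hp1)
  simp only [← sub_eq_add_neg] at this
  exact this.hasProd

lemma tendsto_qPochhammer (a : ℝ) {p : ℝ} (hp0 : 0 < p) (hp1 : p < 1) :
    Tendsto (fun N => ∏ n ∈ Finset.range N, (1 - a * p ^ n)) atTop (𝓝 (qPochhammer a p)) :=
  (hasProd_qPochhammer a hp0 hp1).tendsto_prod_nat

lemma qPochhammer_pos {a p : ℝ} (hp0 : 0 < p) (hp1 : p < 1) (ha0 : 0 ≤ a) (ha : a < 1) :
    0 < qPochhammer a p := by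
  have hpos (n : ℕ) : 0 < 1 - a * p ^ n :=
    sub_pos.2 ((mul_le_of_le_one_right ha0 (pow_le_one₀ hp0.le hp1.le)).trans_lt ha)
  refine lt_of_le_of_ne ?_ ?_
  · exact ge_of_tendsto' (tendsto_qPochhammer a hp0 hp1)
      fun N => Finset.prod_nonneg fun n _ => (hpos n).le
  · have := tprod_one_add_ne_zero_of_summable (f := fun n : ℕ => -(a * p ^ n))
      (fun n => by simpa [← sub_eq_add_neg] using (hpos n).ne')
      (summable_norm_neg_mul_pow a hp0 hp1)
    simp only [← sub_eq_add_neg] at this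
    exact this.symm

lemma tendsto_prod_one_sub_pow_succ {p : ℝ} (hp0 : 0 < p) (hp1 : p < 1) :
    Tendsto (fun N => ∏ n ∈ Finset.range N, (1 - p ^ (n + 1))) atTop (𝓝 (qPochhammer p p)) := by
  simpa only [pow_succ'] using tendsto_qPochhammer p hp0 hp1

lemma prod_one_sub_pow_succ_antitone {p : ℝ} (hp0 : 0 < p) (hp1 : p < 1) :
    Antitone fun N => ∏ n ∈ Finset.range N, (1 - p ^ (n + 1)) := by
  refine antitone_nat_of_succ_le fun N => ?_
  rw [Finset.prod_range_succ]
  refine mul_le_of_le_one_right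
    (Finset.prod_nonneg fun n _ => (one_sub_pow_succ_pos hp0 hp1 n).le) ?_
  have : 0 < p ^ (N + 1) := by positivity
  linarith

lemma invPochhammer_nonneg {p : ℝ} (hp0 : 0 < p) (hp1 : p < 1) (m : ℤ) :
    0 ≤ invPochhammer p m := by
  unfold invPochhammer
  split_ifs
  · exact inv_nonneg.2 (Finset.prod_nonneg fun n _ => (one_sub_pow_succ_pos hp0 hp1 n).le)
  · rfl

lemma invPochhammer_le {p : ℝ} (hp0 : 0 < p) (hp1 : p < 1) (m : ℤ) :
    invPochhammer p m ≤ (qPochhammer p p)⁻¹ := by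
  have hpos := qPochhammer_pos hp0 hp1 hp0.le hp1
  unfold invPochhammer
  split_ifs
  · exact inv_anti₀ hpos ((prod_one_sub_pow_succ_antitone hp0 hp1).le_of_tendsto
      (tendsto_prod_one_sub_pow_succ hp0 hp1) _)
  · exact (inv_pos.2 hpos).le

lemma tendsto_invPochhammer {p : ℝ} (hp0 : 0 < p) (hp1 : p < 1) (k : ℤ) :
    Tendsto (fun N : ℕ => invPochhammer p (N + k)) atTop (𝓝 (qPochhammer p p)⁻¹) := by
  have hpos := qPochhammer_pos hp0 hp1 hp0.le hp1
  have h := (tendsto_prod_one_sub_pow_succ hp0 hp1).inv₀ hpos.ne'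
  have hN : Tendsto (fun N : ℕ => ((N : ℤ) + k).toNat) atTop atTop :=
    tendsto_atTop_atTop.2 fun b => ⟨(b + k.natAbs), fun a ha => by omega⟩
  refine (h.comp hN).congr' ?_
  filter_upwards [eventually_ge_atTop k.natAbs] with N hk
  simp only [Function.comp, invPochhammer]
  rw [if_pos (by omega)]

lemma tendsto_centralGaussBinom {p : ℝ} (hp0 : 0 < p) (hp1 : p < 1) (k : ℤ) :
    Tendsto (fun N => centralGaussBinom p N k) atTop (𝓝 (qPochhammer p p)⁻¹) := by
  have hpos := qPochhammer_pos hp0 hp1 hp0.le hp1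
  have h := ((tendsto_prod_one_sub_pow_succ hp0 hp1).comp
    (tendsto_id.const_mul_atTop' two_pos)).mul
    ((tendsto_invPochhammer hp0 hp1 (-k)).mul (tendsto_invPochhammer hp0 hp1 k))
  rw [mul_inv_cancel_left₀ hpos.ne'] at h
  exact h

lemma norm_centralGaussBinom_le {p : ℝ} (hp0 : 0 < p) (hp1 : p < 1) (N : ℕ) (k : ℤ) :
    ‖centralGaussBinom p N k‖ ≤ (qPochhammer p p)⁻¹ * (qPochhammer p p)⁻¹ := by
  have h0 := invPochhammer_nonneg hp0 hp1
  have h1 := invPochhammer_le hp0 hp1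
  have hprod : 0 ≤ ∏ i ∈ Finset.range (2 * N), (1 - p ^ (i + 1)) :=
    Finset.prod_nonneg fun n _ => (one_sub_pow_succ_pos hp0 hp1 n).le
  rw [centralGaussBinom, Real.norm_of_nonneg (mul_nonneg hprod (mul_nonneg (h0 _) (h0 _)))]
  refine (mul_le_of_le_one_left (mul_nonneg (h0 _) (h0 _)) ?_).trans
    (mul_le_mul (h1 _) (h1 _) (h0 _) ((h0 0).trans (h1 0)))
  simpa using prod_one_sub_pow_succ_antitone hp0 hp1 (Nat.zero_le (2 * N))

lemma summable_norm_jacobi {r : ℝ} (hr0 : 0 < r) (hr1 : r < 1) {z : ℝ} (hz : z ≠ 0) :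
    Summable fun k : ℤ => ‖z ^ k * r ^ (k ^ 2)‖ := by
  have key {w : ℝ} (hw : w ≠ 0) : Summable fun n : ℕ => ‖w ^ n * r ^ (n ^ 2)‖ := by
    refine summable_of_ratio_test_tendsto_lt_one zero_lt_one
      (Eventually.of_forall fun n => by simp [hw, hr0.ne']) ?_
    have h : Tendsto (fun n : ℕ => ‖w‖ * r * (r ^ 2) ^ n) atTop (𝓝 (‖w‖ * r * 0)) :=
      (tendsto_pow_atTop_nhds_zero_of_lt_one (by positivity)
        (pow_lt_one₀ hr0.le hr1 two_ne_zero)).const_mul _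
    rw [mul_zero] at h
    refine h.congr fun n => ?_
    have : ‖w‖ ≠ 0 := norm_ne_zero_iff.2 hw
    simp only [norm_norm, norm_mul, norm_pow, Real.norm_of_nonneg hr0.le]
    rw [eq_div_iff (by positivity)]
    ring
  refine Summable.of_nat_of_neg ((key hz).congr fun n => ?_)
    ((key (inv_ne_zero hz)).congr fun n => ?_)
  · rw [zpow_natCast, ← Nat.cast_pow, zpow_natCast]
  · rw [zpow_neg, zpow_natCast, inv_pow, neg_sq, ← Nat.cast_pow, zpow_natCast]

/-- **Jacobi triple product identity**. -/
theorem hasSum_jacobi_triple {r : ℝ} (hr0 : 0 < r) (hr1 : r < 1) {z : ℝ} (hz : z ≠ 0) :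
    HasSum (fun k : ℤ => z ^ k * r ^ (k ^ 2))
      (qPochhammer (r ^ 2) (r ^ 2) * qPochhammer (-(z * r)) (r ^ 2) *
        qPochhammer (-(z⁻¹ * r)) (r ^ 2)) := by
  have hp0 : 0 < r ^ 2 := by positivity
  have hp1 : r ^ 2 < 1 := pow_lt_one₀ hr0.le hr1 two_ne_zero
  have hpos := qPochhammer_pos hp0 hp1 hp0.le hp1
  have hs := summable_norm_jacobi hr0 hr1 hz
  have h₁ := tendsto_tsum_of_dominated_convergence
    (f := fun (N : ℕ) (k : ℤ) => z ^ k * r ^ (k ^ 2) * centralGaussBinom (r ^ 2) N k)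
    (hs.mul_right ((qPochhammer (r ^ 2) (r ^ 2))⁻¹ * (qPochhammer (r ^ 2) (r ^ 2))⁻¹))
    (fun k => (tendsto_centralGaussBinom hp0 hp1 k).const_mul (z ^ k * r ^ (k ^ 2)))
    (Eventually.of_forall fun N k => by
      rw [norm_mul]
      exact mul_le_mul_of_nonneg_left (norm_centralGaussBinom_le hp0 hp1 N k) (norm_nonneg _))
  have h₂ := (tendsto_qPochhammer (-(z * r)) hp0 hp1).mul
    (tendsto_qPochhammer (-(z⁻¹ * r)) hp0 hp1)
  have h := tendsto_nhds_unique h₁ (h₂.congr fun N => by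
    rw [(hasSum_finite_jacobi hr0 hr1 hz N).tsum_eq, ← Finset.prod_mul_distrib]
    refine Finset.prod_congr rfl fun i _ => ?_
    ring)
  rw [tsum_mul_right, ← div_eq_mul_inv, div_eq_iff hpos.ne'] at h
  convert! hs.of_norm.hasSum using 1
  rw [h]
  ring

/-- The Jacobi triple product for the signed quadratic exponent `a k² + b k`. -/
lemma hasSum_jacobi_triple_neg {x : ℝ} (hx0 : 0 < x) (hx1 : x < 1) {a : ℤ} (ha : 0 < a) (b : ℤ) :
    HasSum (fun k : ℤ => (-1 : ℝ) ^ k * x ^ (a * k ^ 2 + b * k))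
      (qPochhammer (x ^ (2 * a)) (x ^ (2 * a)) * qPochhammer (x ^ (a + b)) (x ^ (2 * a)) *
        qPochhammer (x ^ (a - b)) (x ^ (2 * a))) := by
  have hx := hx0.ne'
  have hz : -x ^ b ≠ 0 := neg_ne_zero.2 (zpow_ne_zero b hx)
  have h := hasSum_jacobi_triple (zpow_pos hx0 a) (zpow_lt_one₀ hx0 hx1 ha) hz
  have e : (x ^ a) ^ 2 = x ^ (2 * a) := by rw [← zpow_natCast, ← zpow_mul]; congr 1; push_cast; ring
  have e₁ : -(-x ^ b * x ^ a) = x ^ (a + b) := by rw [zpow_add₀ hx]; ring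
  have e₂ : -((-x ^ b)⁻¹ * x ^ a) = x ^ (a - b) := by
    rw [zpow_sub₀ hx, inv_neg, div_eq_mul_inv]; ring
  rw [e, e₁, e₂] at h
  convert! h using 2 with k
  rw [neg_eq_neg_one_mul (x ^ b), mul_zpow, ← zpow_mul, ← zpow_mul, mul_assoc, ← zpow_add₀ hx]
  congr 2; ring

lemma summable_zpow_quadratic {x : ℝ} (hx0 : 0 < x) (hx1 : x < 1) {a : ℤ} (ha : 0 < a) (b c : ℤ) :
    Summable fun k : ℤ => x ^ (a * k ^ 2 + b * k + c) := by
  have hx := hx0.ne'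
  refine ((hasSum_jacobi_triple_neg hx0 hx1 ha b).summable.abs.mul_right (x ^ c)).congr fun k => ?_
  rw [abs_mul, abs_zpow, abs_neg, abs_one, one_zpow, one_mul, abs_of_pos (zpow_pos hx0 _),
    ← zpow_add₀ hx]

lemma hasSum_int_even_add_odd {f : ℤ → ℝ} {s t : ℝ} (he : HasSum (fun k => f (2 * k)) s)
    (ho : HasSum (fun k => f (2 * k + 1)) t) : HasSum f (s + t) := by
  have hinj := mul_right_injective₀ (two_ne_zero' ℤ)
  replace ho := ((add_left_injective 1).comp hinj).hasSum_range_iff.2 ho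
  refine (hinj.hasSum_range_iff.2 he).add_isCompl ?_ ho
  simpa [Function.comp_def] using Int.isCompl_even_odd

/-- Dissection of an infinite `q`-Pochhammer symbol by residues modulo `m`. -/
lemma qPochhammer_dissection {x : ℝ} (hx0 : 0 < x) (hx1 : x < 1) (c : ℤ) {d : ℤ} (hd : 0 < d)
    (m : ℕ) [NeZero m] :
    qPochhammer (x ^ c) (x ^ d) = ∏ i : Fin m, qPochhammer (x ^ (c + d * i)) (x ^ (d * m)) := by
  have hx := hx0.ne'
  have hm : (0 : ℤ) < m := by exact_mod_cast Nat.pos_of_neZero m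
  have h := hasProd_qPochhammer (x ^ c) (zpow_pos hx0 d) (zpow_lt_one₀ hx0 hx1 hd)
  rw [← (Nat.divModEquiv m).symm.hasProd_iff, ← (Equiv.prodComm _ _).hasProd_iff] at h
  refine (h.prod_fiberwise (g := fun i : Fin m => qPochhammer (x ^ (c + d * i)) (x ^ (d * m)))
    fun i => ?_).unique (hasProd_fintype _)
  convert! hasProd_qPochhammer (x ^ (c + d * i)) (zpow_pos hx0 (d * m))
    (zpow_lt_one₀ hx0 hx1 (mul_pos hd hm)) using 2 with n
  simp only [Function.comp, Equiv.prodComm_apply, Prod.swap, Nat.divModEquiv_symm_apply]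
  simp only [← zpow_natCast, ← zpow_mul, ← zpow_add₀ hx]
  congr 2; push_cast; ring

lemma qPochhammer_one (p : ℝ) : qPochhammer 1 p = 0 :=
  tprod_of_exists_eq_zero ⟨0, by simp⟩

/-- The change of variables on `ℤ × ℤ` used to dissect the product of two theta series according
to the residue of `i + 2 * j` modulo `3`. -/
def latticeEquiv : Fin 3 × (ℤ × ℤ) ≃ ℤ × ℤ where
  toFun v := (v.2.1 + v.1 - 2 * v.2.2, v.2.1 + v.2.2)
  invFun w := (⟨((w.1 + 2 * w.2) % 3).toNat, by omega⟩,
    ((w.1 + 2 * w.2) / 3, w.2 - (w.1 + 2 * w.2) / 3))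
  left_inv := by
    rintro ⟨a, r, m⟩
    have := a.isLt
    ext <;> simp <;> omega
  right_inv := by
    rintro ⟨i, j⟩
    ext <;> simp
    omega

/-- The quintuple product identity in the specialization needed for the characters `χ_{5,6}`. -/
lemma tsum_sub_tsum_eq_quintuple_product {x : ℝ} (hx0 : 0 < x) (hx1 : x < 1) :
    (∑' k : ℤ, x ^ (15 * k ^ 2 + k)) - ∑' k : ℤ, x ^ (15 * k ^ 2 + 11 * k + 2) =
      qPochhammer (x ^ (10 : ℤ)) (x ^ (10 : ℤ)) * qPochhammer (x ^ (2 : ℤ)) (x ^ (10 : ℤ)) *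
        qPochhammer (x ^ (8 : ℤ)) (x ^ (10 : ℤ)) *
        (qPochhammer (x ^ (14 : ℤ)) (x ^ (20 : ℤ)) * qPochhammer (x ^ (6 : ℤ)) (x ^ (20 : ℤ))) := by
  have hx := hx0.ne'
  have hs : Summable fun k : ℤ => x ^ (15 * k ^ 2 + k) :=
    (summable_zpow_quadratic hx0 hx1 (a := 15) (by norm_num) 1 0).congr fun k => by
      congr 1; ring
  have ht := summable_zpow_quadratic hx0 hx1 (a := 15) (by norm_num) 11 2
  have hA := hasSum_jacobi_triple_neg hx0 hx1 (a := 5) (by norm_num) (-3)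
  have hB := hasSum_jacobi_triple_neg hx0 hx1 (a := 10) (by norm_num) 4
  have hC := hasSum_jacobi_triple_neg hx0 hx1 (a := 30) (by norm_num) 10
  have hC' := hasSum_jacobi_triple_neg hx0 hx1 (a := 30) (by norm_num) (-10)
  have hD := hasSum_jacobi_triple_neg hx0 hx1 (a := 30) (by norm_num) (-30)
  have hu := summable_zpow_quadratic hx0 hx1 (a := 15) (by norm_num) 21 14
  have hC_eq : qPochhammer (x ^ (20 : ℤ)) (x ^ (20 : ℤ)) =
      qPochhammer (x ^ (60 : ℤ)) (x ^ (60 : ℤ)) * qPochhammer (x ^ (40 : ℤ)) (x ^ (60 : ℤ)) *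
        qPochhammer (x ^ (20 : ℤ)) (x ^ (60 : ℤ)) := by
    rw [qPochhammer_dissection hx0 hx1 20 (d := 20) (by norm_num) 3]
    simp [Fin.prod_univ_succ]
    ring
  simp only [Int.reduceMul, Int.reduceAdd, Int.reduceSub, Int.reduceNeg, zpow_zero,
    qPochhammer_one, mul_zero, zero_mul] at hA hB hC hC' hD
  rw [mul_right_comm, ← hC_eq] at hC'
  rw [← hC_eq] at hC
  have mulSum {f g : ℤ → ℝ} {u v : ℝ} (hf : HasSum f u) (hg : HasSum g v) :=
    hf.mul hg (summable_mul_of_summable_norm hf.summable.norm hg.summable.norm)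
  have hAB := latticeEquiv.hasSum_iff.2 (mulSum hA hB)
  have key := (hAB.prod_fiberwise (g := ![(∑' k : ℤ, x ^ (15 * k ^ 2 + k)) *
      qPochhammer (x ^ (20 : ℤ)) (x ^ (20 : ℤ)),
      -((∑' k : ℤ, x ^ (15 * k ^ 2 + 11 * k + 2)) * qPochhammer (x ^ (20 : ℤ)) (x ^ (20 : ℤ))),
      0]) fun a => ?_).unique (hasSum_fintype _)
  · have hpos := qPochhammer_pos (zpow_pos hx0 20) (zpow_lt_one₀ hx0 hx1
      (by norm_num)) (zpow_pos hx0 20).le (zpow_lt_one₀ hx0 hx1 (by norm_num))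
    simp only [Fin.sum_univ_three, Matrix.cons_val] at key
    refine mul_right_cancel₀ hpos.ne' ?_
    linear_combination -key
  · have sign (a : ℤ) (v : ℤ × ℤ) : (-1 : ℝ) ^ (v.1 + a - 2 * v.2) * (-1 : ℝ) ^ (v.1 + v.2) =
        (-1) ^ a * (-1) ^ v.2 := by
      rw [← zpow_add₀ (by norm_num), ← zpow_add₀ (by norm_num),
        show v.1 + a - 2 * v.2 + (v.1 + v.2) = 2 * (v.1 - v.2) + (a + v.2) by ring,
        zpow_add₀ (by norm_num), zpow_mul]
      norm_num
    have term (a : ℤ) (v : ℤ × ℤ) :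
        (-1 : ℝ) ^ (v.1 + a - 2 * v.2) *
            x ^ (5 * (v.1 + a - 2 * v.2) ^ 2 + -3 * (v.1 + a - 2 * v.2)) *
          ((-1 : ℝ) ^ (v.1 + v.2) * x ^ (10 * (v.1 + v.2) ^ 2 + 4 * (v.1 + v.2))) =
        (-1) ^ a * (x ^ (15 * v.1 ^ 2 + (10 * a + 1) * v.1 + (5 * a ^ 2 - 3 * a)) *
          ((-1) ^ v.2 * x ^ (30 * v.2 ^ 2 + (10 - 20 * a) * v.2))) := by
      rw [mul_mul_mul_comm, sign, ← zpow_add₀ hx, mul_left_comm (x ^ _), ← zpow_add₀ hx, mul_assoc]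
      congr 3; ring
    fin_cases a
    · convert! mulSum hs.hasSum hC using 2 with v
      exact (term 0 v).trans (by norm_num)
    · convert! (mulSum ht.hasSum hC').neg using 2 with v
      exact (term 1 v).trans (by norm_num)
    · convert! mulSum hu.hasSum hD using 2 with v
      · exact (term 2 v).trans (by norm_num)
      · exact (mul_zero _).symm

lemma eulerProd_eq_qPochhammer (q : ℝ) : eulerProd q = qPochhammer q q := by
  simp only [eulerProd, qPochhammer, pow_succ']

theorem twisted_W_two_fifths_character_product_form (q : ℝ) (hq0 : 0 < q) (hq1 : q < 1) :
    minChar 5 6 1 1 q - minChar 5 6 1 5 q =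
      q ^ (-(1 : ℝ) / 30) *
        ∏' n : ℕ, ((1 - q ^ (10 * n + 2)) * (1 - q ^ (10 * n + 8)))⁻¹ := by
  obtain ⟨x, hx0, hxq⟩ : ∃ x : ℝ, 0 < x ∧ q = x ^ (2 : ℤ) :=
    ⟨√q, Real.sqrt_pos.2 hq0, (Real.sq_sqrt hq0.le).symm⟩
  have hx1 : x < 1 := by
    by_contra! h
    exact hq1.not_ge (hxq ▸ one_le_zpow₀ h (by norm_num))
  have hx := hx0.ne'
  have qpow (n : ℤ) : q ^ n = x ^ (2 * n) := by rw [hxq, ← zpow_mul]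
  have qpow_nat (n : ℕ) : q ^ n = x ^ (2 * n : ℤ) := by rw [← zpow_natCast, qpow]
  have hst := tsum_sub_tsum_eq_quintuple_product hx0 hx1
  have sum₁ (b c : ℤ) : Summable fun k : ℤ => q ^ (30 * k ^ 2 + b * k + c) :=
    summable_zpow_quadratic hq0 hq1 (by norm_num) b c
  have hs : HasSum (fun k : ℤ => x ^ (15 * k ^ 2 + k))
      ((∑' k : ℤ, q ^ (30 * k ^ 2 + 1 * k + 0)) + ∑' k : ℤ, q ^ (30 * k ^ 2 + 31 * k + 8)) := by
    refine hasSum_int_even_add_odd ?_ ?_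
    · convert! (sum₁ 1 0).hasSum using 2 with k
      rw [qpow]; congr 1; ring
    · convert! (sum₁ 31 8).hasSum using 2 with k
      rw [qpow]; congr 1; ring
  have ht : HasSum (fun k : ℤ => x ^ (15 * k ^ 2 + 11 * k + 2))
      ((∑' k : ℤ, q ^ (30 * k ^ 2 + 11 * k + 1)) + ∑' k : ℤ, q ^ (30 * k ^ 2 + -19 * k + 3)) := by
    refine hasSum_int_even_add_odd ?_ ?_
    · convert! (sum₁ 11 1).hasSum using 2 with k
      rw [qpow]; congr 1; ring
    · rw [← (Equiv.subRight (1 : ℤ)).hasSum_iff]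
      convert! (sum₁ (-19) 3).hasSum using 2 with k
      simp only [Function.comp, Equiv.subRight_apply]
      rw [qpow]; congr 1; ring
  rw [hs.tsum_eq, ht.tsum_eq] at hst
  have char₁ : minChar 5 6 1 1 q = q ^ (-(1 : ℝ) / 30) * (eulerProd q)⁻¹ *
      ((∑' k : ℤ, q ^ (30 * k ^ 2 + 1 * k + 0)) - ∑' k : ℤ, q ^ (30 * k ^ 2 + 11 * k + 1)) := by
    rw [← (sum₁ 1 0).tsum_sub (sum₁ 11 1), minChar]
    norm_num
  have char₂ : minChar 5 6 1 5 q = q ^ (-(1 : ℝ) / 30) * (eulerProd q)⁻¹ *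
      ((∑' k : ℤ, q ^ (30 * k ^ 2 + -19 * k + 3)) - ∑' k : ℤ, q ^ (30 * k ^ 2 + 31 * k + 8)) := by
    have shift (b c : ℤ) : ∑' k : ℤ, q ^ (30 * k ^ 2 + b * k + (c + 3)) =
        q ^ (3 : ℝ) * ∑' k : ℤ, q ^ (30 * k ^ 2 + b * k + c) := by
      rw [← tsum_mul_left]
      refine tsum_congr fun k => ?_
      rw [← add_assoc, zpow_add₀ hq0.ne', mul_comm]
      norm_cast
    rw [show (3 : ℤ) = 0 + 3 by norm_num, show (8 : ℤ) = 5 + 3 by norm_num, shift, shift, ← mul_sub,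
      ← (sum₁ (-19) 0).tsum_sub (sum₁ 31 5), mul_right_comm _ (eulerProd q)⁻¹, ← mul_assoc,
      ← Real.rpow_add hq0, minChar, mul_right_comm _ (eulerProd q)⁻¹]
    congr 2
    · norm_num
    · refine tsum_congr fun k => ?_
      congr 2; ring
  have qP_pos (c : ℤ) (hc : 0 < c) : 0 < qPochhammer (x ^ c) (x ^ (20 : ℤ)) :=
    qPochhammer_pos (zpow_pos hx0 20) (zpow_lt_one₀ hx0 hx1 (by norm_num))
      (zpow_pos hx0 c).le (zpow_lt_one₀ hx0 hx1 hc)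
  have prod_eq : ∏' n : ℕ, ((1 - q ^ (10 * n + 2)) * (1 - q ^ (10 * n + 8)))⁻¹ =
      (qPochhammer (x ^ (4 : ℤ)) (x ^ (20 : ℤ)) * qPochhammer (x ^ (16 : ℤ)) (x ^ (20 : ℤ)))⁻¹ := by
    have h20 : x ^ (20 : ℤ) < 1 := zpow_lt_one₀ hx0 hx1 (by norm_num)
    refine HasProd.tprod_eq (HasProd.inv₀ ?_
      (mul_pos (qP_pos 4 (by norm_num)) (qP_pos 16 (by norm_num))).ne')
    convert! (hasProd_qPochhammer (x ^ (4 : ℤ)) (zpow_pos hx0 20) h20).mul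
      (hasProd_qPochhammer (x ^ (16 : ℤ)) (zpow_pos hx0 20) h20) using 2 with n
    rw [qpow_nat, qpow_nat, ← zpow_natCast, ← zpow_mul, ← zpow_add₀ hx, ← zpow_add₀ hx]
    congr 3 <;> push_cast <;> ring
  have d₁₀ (c : ℤ) : qPochhammer (x ^ c) (x ^ (10 : ℤ)) =
      qPochhammer (x ^ c) (x ^ (20 : ℤ)) * qPochhammer (x ^ (c + 10)) (x ^ (20 : ℤ)) := by
    rw [qPochhammer_dissection hx0 hx1 c (d := 10) (by norm_num) 2]
    simp [Fin.prod_univ_succ]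
  have euler : eulerProd q = ∏ i : Fin 10, qPochhammer (x ^ (2 + 2 * i : ℤ)) (x ^ (20 : ℤ)) := by
    rw [eulerProd_eq_qPochhammer, hxq, qPochhammer_dissection hx0 hx1 2 (by norm_num) 10]
    rfl
  have euler_pos : 0 < eulerProd q :=
    eulerProd_eq_qPochhammer q ▸ qPochhammer_pos hq0 hq1 hq0.le hq1
  simp only [d₁₀, Int.reduceAdd] at hst
  rw [char₁, char₂, prod_eq, mul_assoc, mul_assoc, ← mul_sub, ← mul_sub]
  congr 1
  rw [inv_mul_eq_div, div_eq_iff euler_pos.ne', ← div_eq_inv_mul,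
    eq_div_iff (mul_pos (qP_pos 4 (by norm_num)) (qP_pos 16 (by norm_num))).ne', euler]
  simp only [Fin.prod_univ_succ, Fin.prod_univ_zero, Fin.val_zero, Fin.val_succ, Nat.cast_add,
    Nat.cast_zero, Nat.cast_one, Int.reduceAdd, Int.reduceMul]
  linear_combination
    qPochhammer (x ^ (4 : ℤ)) (x ^ (20 : ℤ)) * qPochhammer (x ^ (16 : ℤ)) (x ^ (20 : ℤ)) * hst
end
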